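/- arXiv:2208.12749 — 2 statements merged into one kernel-verified Lean document; each statement's English description precedes it below -/
import Mathlib

section
/- Let β ∈ K with β ∉ {0, 10/3, −10/3} be such that the plane sextic C : X⁶ + Y⁵Z + YZ⁵ + βY³Z³ = 0 is smooth. Then Aut(C) ⊂ PGL₃(K) equals the subgroup generated by σ = diag(1, ζ₁₂, ζ₁₂⁷) and τ = [X:Z:Y], has order 24, and is isomorphic to the direct product Z/3Z × D₈, where D₈ denotes the dihedral group of order 8. -/
open MvPolynomial

/-- `GL₃(K)`: the group of invertible `3 × 3` matrices over `K`. -/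
abbrev GL3 (K : Type*) [Field K] := (Matrix (Fin 3) (Fin 3) K)ˣ

/-- `PGL₃(K)`: the quotient of `GL₃(K)` by its center (the scalar matrices). -/
abbrev PGL3 (K : Type*) [Field K] := GL3 K ⧸ Subgroup.center (GL3 K)

variable {K : Type*} [Field K]

/-- The substitution `F(X,Y,Z) ↦ F(A·(X,Y,Z)ᵗ)` for a `3 × 3` matrix `A`. -/
noncomputable def matAct (A : Matrix (Fin 3) (Fin 3) K) (F : MvPolynomial (Fin 3) K) :
    MvPolynomial (Fin 3) K :=
  aeval (fun i => ∑ j, C (A i j) * X j) F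

lemma matAct_one (F : MvPolynomial (Fin 3) K) : matAct 1 F = F := by
  unfold matAct
  have h : (fun i => ∑ j, C ((1 : Matrix (Fin 3) (Fin 3) K) i j) * X j)
      = (X : Fin 3 → MvPolynomial (Fin 3) K) := by
    funext i
    rw [Finset.sum_eq_single i]
    · simp
    · intro b _ hb
      simp [Matrix.one_apply, Ne.symm hb]
    · simp
  rw [h, aeval_X_left_apply]

lemma matAct_matAct (A B : Matrix (Fin 3) (Fin 3) K) (F : MvPolynomial (Fin 3) K) :
    matAct B (matAct A F) = matAct (A * B) F := by
  unfold matAct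
  rw [← AlgHom.comp_apply, comp_aeval]
  have h : (fun i => (aeval fun i => ∑ j, C (B i j) * X j) (∑ j, C (A i j) * X j))
      = fun i => ∑ j : Fin 3, C ((A * B) i j) * (X j : MvPolynomial (Fin 3) K) := by
    funext i
    simp only [map_sum, map_mul, aeval_C, aeval_X, algebraMap_eq, Finset.mul_sum]
    rw [Finset.sum_comm]
    refine Finset.sum_congr rfl fun k _ => ?_
    rw [Matrix.mul_apply, map_sum, Finset.sum_mul]
    refine Finset.sum_congr rfl fun j _ => ?_
    rw [map_mul, mul_assoc]
  rw [h]

lemma matAct_smul (A : Matrix (Fin 3) (Fin 3) K) (c : K) (F : MvPolynomial (Fin 3) K) :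
    matAct A (c • F) = c • matAct A F :=
  map_smul (aeval fun i => ∑ j, C (A i j) * X j) c F

/-- The class of a matrix `A` in `PGL₃(K)` (junk value `1` if `A` is not invertible). -/
noncomputable def pgl (A : Matrix (Fin 3) (Fin 3) K) : PGL3 K := by
  classical
  exact if h : IsUnit A then (QuotientGroup.mk h.unit : PGL3 K) else 1

/-- `F` defines a smooth plane sextic: `F` is homogeneous of degree `6`, and `F` together with
its partial derivatives have no common zero besides the origin. -/
def IsSmoothSextic (F : MvPolynomial (Fin 3) K) : Prop :=
  F.IsHomogeneous 6 ∧
    ∀ p : Fin 3 → K, eval p F = 0 → (∀ i, eval p (pderiv i F) = 0) → p = 0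

/-- The automorphism group of the plane curve `F = 0`: the subgroup of `PGL₃(K)` consisting of
the classes of matrices `A ∈ GL₃(K)` with `F(A·(X,Y,Z)ᵗ) = λ·F(X,Y,Z)` for some `λ ∈ K×`. -/
noncomputable def planeAut (F : MvPolynomial (Fin 3) K) : Subgroup (PGL3 K) where
  carrier := {g | ∃ A : GL3 K, (QuotientGroup.mk A : PGL3 K) = g ∧
    ∃ c : K, c ≠ 0 ∧ matAct (A : Matrix (Fin 3) (Fin 3) K) F = c • F}
  one_mem' := ⟨1, rfl, 1, one_ne_zero, by rw [Units.val_one, matAct_one, one_smul]⟩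
  mul_mem' := by
    rintro g h ⟨A, rfl, c, hc, hA⟩ ⟨B, rfl, d, hd, hB⟩
    exact ⟨A * B, rfl, c * d, mul_ne_zero hc hd, by
      rw [Units.val_mul, ← matAct_matAct, hA, matAct_smul, hB, smul_smul]⟩
  inv_mem' := by
    rintro g ⟨A, rfl, c, hc, hA⟩
    refine ⟨A⁻¹, rfl, c⁻¹, inv_ne_zero hc, ?_⟩
    rw [eq_inv_smul_iff₀ hc, ← matAct_smul, ← hA, matAct_matAct, ← Units.val_mul,
      mul_inv_cancel, Units.val_one, matAct_one]

lemma coeff_eq_zero_of_forall_sextic_eq_zero {K : Type*} [Field K] [CharZero K]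
    {a₀ a₁ a₂ a₃ a₄ a₅ a₆ : K}
    (h : ∀ t : K, a₀ + a₁ * t + a₂ * t ^ 2 + a₃ * t ^ 3 + a₄ * t ^ 4 + a₅ * t ^ 5
      + a₆ * t ^ 6 = 0) :
    a₀ = 0 ∧ a₁ = 0 ∧ a₂ = 0 ∧ a₃ = 0 ∧ a₄ = 0 ∧ a₅ = 0 ∧ a₆ = 0 := by
  have hp : (Polynomial.C a₀ + Polynomial.C a₁ * Polynomial.X
      + Polynomial.C a₂ * Polynomial.X ^ 2 + Polynomial.C a₃ * Polynomial.X ^ 3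
      + Polynomial.C a₄ * Polynomial.X ^ 4 + Polynomial.C a₅ * Polynomial.X ^ 5
      + Polynomial.C a₆ * Polynomial.X ^ 6 : Polynomial K) = 0 :=
    Polynomial.funext fun t => by simpa using h t
  have hc := fun n => congrArg (fun P => Polynomial.coeff P n) hp
  refine ⟨?_, ?_, ?_, ?_, ?_, ?_, ?_⟩
  · simpa [Polynomial.coeff_X, Polynomial.coeff_C, Polynomial.coeff_X_pow] using hc 0
  · simpa [Polynomial.coeff_X, Polynomial.coeff_C, Polynomial.coeff_X_pow] using hc 1
  · simpa [Polynomial.coeff_X, Polynomial.coeff_C, Polynomial.coeff_X_pow] using hc 2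
  · simpa [Polynomial.coeff_X, Polynomial.coeff_C, Polynomial.coeff_X_pow] using hc 3
  · simpa [Polynomial.coeff_X, Polynomial.coeff_C, Polynomial.coeff_X_pow] using hc 4
  · simpa [Polynomial.coeff_X, Polynomial.coeff_C, Polynomial.coeff_X_pow] using hc 5
  · simpa [Polynomial.coeff_X, Polynomial.coeff_C, Polynomial.coeff_X_pow] using hc 6

/-- A directional derivative of `X⁶ + Y⁵Z + YZ⁵ + βY³Z³` is the fifth power of a linear form only
along the `X`-axis, and then the linear form is a multiple of `X`. -/
lemma polar_eq_pow_five {K : Type*} [Field K] [CharZero K] {β c w₀ w₁ w₂ l m n : K}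
    (hβ : (3 * β) ^ 2 ≠ 100) (hc : c ≠ 0) (hw : w₀ ≠ 0 ∨ w₁ ≠ 0 ∨ w₂ ≠ 0)
    (h : ∀ x y z : K, 6 * w₀ * x ^ 5 + w₁ * (5 * y ^ 4 * z + z ^ 5 + 3 * β * y ^ 2 * z ^ 3)
      + w₂ * (y ^ 5 + 5 * y * z ^ 4 + 3 * β * y ^ 3 * z ^ 2)
      = 6 * c * (l * x + m * y + n * z) ^ 5) :
    w₁ = 0 ∧ w₂ = 0 ∧ l ≠ 0 ∧ m = 0 ∧ n = 0 := by
  obtain ⟨-, -, -, -, hm, hl, -⟩ := coeff_eq_zero_of_forall_sextic_eq_zero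
    (a₀ := w₂ - 6 * c * m ^ 5) (a₁ := -30 * c * m ^ 4 * l)
    (a₂ := -60 * c * m ^ 3 * l ^ 2) (a₃ := -60 * c * m ^ 2 * l ^ 3)
    (a₄ := -30 * c * m * l ^ 4) (a₅ := 6 * w₀ - 6 * c * l ^ 5) (a₆ := 0)
    fun t => by linear_combination h t 1 0
  obtain ⟨-, -, -, -, hn, -, -⟩ := coeff_eq_zero_of_forall_sextic_eq_zero
    (a₀ := w₁ - 6 * c * n ^ 5) (a₁ := -30 * c * n ^ 4 * l)
    (a₂ := -60 * c * n ^ 3 * l ^ 2) (a₃ := -60 * c * n ^ 2 * l ^ 3)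
    (a₄ := -30 * c * n * l ^ 4) (a₅ := 6 * w₀ - 6 * c * l ^ 5) (a₆ := 0)
    fun t => by linear_combination h t 0 1
  obtain ⟨h0, h1, h2, h3, h4, h5, -⟩ := coeff_eq_zero_of_forall_sextic_eq_zero
    (a₀ := w₂ - 6 * c * m ^ 5) (a₁ := 5 * w₁ - 30 * c * m ^ 4 * n)
    (a₂ := 3 * β * w₂ - 60 * c * m ^ 3 * n ^ 2) (a₃ := 3 * β * w₁ - 60 * c * m ^ 2 * n ^ 3)
    (a₄ := 5 * w₂ - 30 * c * m * n ^ 4) (a₅ := w₁ - 6 * c * n ^ 5) (a₆ := 0)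
    fun t => by linear_combination h 0 1 t
  have hl0 : l ≠ 0 := by
    rintro rfl
    have hw0 : w₀ = 0 := by linear_combination hl / 6
    have hm0 : m = 0 := by
      by_contra hm0
      have e1 : m ^ 4 = n ^ 4 := by
        have : c * m * (m ^ 4 - n ^ 4) = 0 := by linear_combination h4 / 30 - h0 / 6
        simpa [hc, hm0, sub_eq_zero] using this
      have e2 : 3 * β * m ^ 2 = 10 * n ^ 2 := by
        have : c * m ^ 3 * (3 * β * m ^ 2 - 10 * n ^ 2) = 0 := by
          linear_combination h2 / 6 - 3 * β * h0 / 6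
        simpa [hc, hm0, sub_eq_zero] using this
      have e3 : m ^ 4 * ((3 * β) ^ 2 - 100) = 0 := by
        linear_combination (3 * β * m ^ 2 + 10 * n ^ 2) * e2 - 100 * e1
      simp [hm0, sub_eq_zero, hβ] at e3
    subst hm0
    have hw2 : w₂ = 0 := by linear_combination h0
    have hw1 : w₁ = 0 := by linear_combination h1 / 5
    simp [hw0, hw1, hw2] at hw
  have hm0 : m = 0 := by simpa [hc, hl0] using hm
  have hn0 : n = 0 := by simpa [hc, hl0] using hn
  subst hm0 hn0
  exact ⟨by linear_combination h5, by linear_combination h0, hl0, rfl, rfl⟩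

/-- A linear substitution preserving `Y⁵Z + YZ⁵ + βY³Z³` up to a scalar preserves `YZ` up to a
scalar. This comes from the quadratic covariant `(f, (f, f)₄)₄` of binary sextics `f`, which here
is a multiple of `β (9β² - 100) YZ`. -/
lemma binary_sextic_semiinvariant {K : Type*} [Field K] [CharZero K] {β c p q r s : K}
    (hβ0 : β ≠ 0) (hβ : (3 * β) ^ 2 ≠ 100) (hd : p * s - q * r ≠ 0)
    (h : ∀ y z : K, (p * y + q * z) ^ 5 * (r * y + s * z) + (p * y + q * z) * (r * y + s * z) ^ 5
      + β * (p * y + q * z) ^ 3 * (r * y + s * z) ^ 3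
      = c * (y ^ 5 * z + y * z ^ 5 + β * y ^ 3 * z ^ 3)) :
    p * r = 0 ∧ q * s = 0 := by
  obtain ⟨h0, h1, h2, h3, h4, h5, h6⟩ := coeff_eq_zero_of_forall_sextic_eq_zero
    (a₀ := p ^ 5 * r + p * r ^ 5 + β * p ^ 3 * r ^ 3)
    (a₁ := p ^ 5 * s + 5 * p ^ 4 * q * r + r ^ 5 * q + 5 * r ^ 4 * s * p
      + β * (3 * p ^ 3 * r ^ 2 * s + 3 * p ^ 2 * q * r ^ 3) - c)
    (a₂ := 5 * p ^ 4 * q * s + 10 * p ^ 3 * q ^ 2 * r + 5 * r ^ 4 * s * q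
      + 10 * r ^ 3 * s ^ 2 * p
      + β * (3 * p ^ 3 * r * s ^ 2 + 9 * p ^ 2 * q * r ^ 2 * s + 3 * p * q ^ 2 * r ^ 3))
    (a₃ := 10 * p ^ 3 * q ^ 2 * s + 10 * p ^ 2 * q ^ 3 * r + 10 * r ^ 3 * s ^ 2 * q
      + 10 * r ^ 2 * s ^ 3 * p
      + β * (p ^ 3 * s ^ 3 + 9 * p ^ 2 * q * r * s ^ 2 + 9 * p * q ^ 2 * r ^ 2 * s
        + q ^ 3 * r ^ 3) - c * β)
    (a₄ := 10 * p ^ 2 * q ^ 3 * s + 5 * p * q ^ 4 * r + 10 * r ^ 2 * s ^ 3 * q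
      + 5 * r * s ^ 4 * p
      + β * (3 * p ^ 2 * q * s ^ 3 + 9 * p * q ^ 2 * r * s ^ 2 + 3 * q ^ 3 * r ^ 2 * s))
    (a₅ := 5 * p * q ^ 4 * s + q ^ 5 * r + 5 * r * s ^ 4 * q + s ^ 5 * p
      + β * (3 * p * q ^ 2 * s ^ 3 + 3 * q ^ 3 * r * s ^ 2) - c)
    (a₆ := q ^ 5 * s + q * s ^ 5 + β * q ^ 3 * s ^ 3)
    fun t => by linear_combination h 1 t
  -- the coefficients of the quartic covariant `(f, f)₄`, as functions of those of `f`
  have hcov : ∀ A0 A1 A2 A3 A4 A5 A6 : K,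
      A0 = 0 → A1 = c / 6 → A2 = 0 → A3 = c * β / 20 → A4 = 0 → A5 = c / 6 → A6 = 0 →
      A0 * A4 - 4 * A1 * A3 + 3 * A2 ^ 2 = - c ^ 2 * β / 30 ∧
      2 * (A0 * A5 - 3 * A1 * A4 + 2 * A2 * A3) = 0 ∧
      A0 * A6 - 9 * A2 * A4 + 8 * A3 ^ 2 = c ^ 2 * β ^ 2 / 50 ∧
      2 * (A1 * A6 - 3 * A2 * A5 + 2 * A3 * A4) = 0 ∧
      A2 * A6 - 4 * A3 * A5 + 3 * A4 ^ 2 = - c ^ 2 * β / 30 := by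
    rintro _ _ _ _ _ _ _ rfl rfl rfl rfl rfl rfl rfl
    refine ⟨?_, ?_, ?_, ?_, ?_⟩ <;> ring
  obtain ⟨i0, i1, i2, i3, i4⟩ := hcov
    (p ^ 5 * r + p * r ^ 5 + β * p ^ 3 * r ^ 3)
    ((p ^ 5 * s + 5 * p ^ 4 * q * r + r ^ 5 * q + 5 * r ^ 4 * s * p
      + β * (3 * p ^ 3 * r ^ 2 * s + 3 * p ^ 2 * q * r ^ 3)) / 6)
    ((5 * p ^ 4 * q * s + 10 * p ^ 3 * q ^ 2 * r + 5 * r ^ 4 * s * q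
      + 10 * r ^ 3 * s ^ 2 * p
      + β * (3 * p ^ 3 * r * s ^ 2 + 9 * p ^ 2 * q * r ^ 2 * s + 3 * p * q ^ 2 * r ^ 3)) / 15)
    ((10 * p ^ 3 * q ^ 2 * s + 10 * p ^ 2 * q ^ 3 * r + 10 * r ^ 3 * s ^ 2 * q
      + 10 * r ^ 2 * s ^ 3 * p
      + β * (p ^ 3 * s ^ 3 + 9 * p ^ 2 * q * r * s ^ 2 + 9 * p * q ^ 2 * r ^ 2 * s
        + q ^ 3 * r ^ 3)) / 20)
    ((10 * p ^ 2 * q ^ 3 * s + 5 * p * q ^ 4 * r + 10 * r ^ 2 * s ^ 3 * q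
      + 5 * r * s ^ 4 * p
      + β * (3 * p ^ 2 * q * s ^ 3 + 9 * p * q ^ 2 * r * s ^ 2 + 3 * q ^ 3 * r ^ 2 * s)) / 15)
    ((5 * p * q ^ 4 * s + q ^ 5 * r + 5 * r * s ^ 4 * q + s ^ 5 * p
      + β * (3 * p * q ^ 2 * s ^ 3 + 3 * q ^ 3 * r * s ^ 2)) / 6)
    (q ^ 5 * s + q * s ^ 5 + β * q ^ 3 * s ^ 3)
    h0 (by linear_combination h1 / 6) (by linear_combination h2 / 15)
    (by linear_combination h3 / 20) (by linear_combination h4 / 15)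
    (by linear_combination h5 / 6) h6
  have j0 : (p * s - q * r) ^ 4 * (-5 * (p ^ 4 + r ^ 4) + 3 * β * p ^ 2 * r ^ 2)
      = -5 * c ^ 2 := by
    refine mul_left_cancel₀ hβ0 ?_
    linear_combination 150 * i0
  have j1 : (p * s - q * r) ^ 4 * (-20 * (p ^ 3 * q + r ^ 3 * s)
      + 6 * β * (p * q * r ^ 2 + p ^ 2 * r * s)) = 0 := by
    refine mul_left_cancel₀ hβ0 ?_
    linear_combination 150 * i1
  have j2 : (p * s - q * r) ^ 4 * (-30 * (p ^ 2 * q ^ 2 + r ^ 2 * s ^ 2)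
      + 3 * β * (p ^ 2 * s ^ 2 + 4 * p * q * r * s + q ^ 2 * r ^ 2)) = 3 * β * c ^ 2 := by
    refine mul_left_cancel₀ hβ0 ?_
    linear_combination 150 * i2
  have j3 : (p * s - q * r) ^ 4 * (-20 * (p * q ^ 3 + r * s ^ 3)
      + 6 * β * (p * q * s ^ 2 + q ^ 2 * r * s)) = 0 := by
    refine mul_left_cancel₀ hβ0 ?_
    linear_combination 150 * i3
  have j4 : (p * s - q * r) ^ 4 * (-5 * (q ^ 4 + s ^ 4) + 3 * β * q ^ 2 * s ^ 2)
      = -5 * c ^ 2 := by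
    refine mul_left_cancel₀ hβ0 ?_
    linear_combination 150 * i4
  clear i0 i1 i2 i3 i4 hcov
  have hcov : ∀ A0 A1 A2 A3 A4 A5 A6 B0 B1 B2 B3 B4 d : K,
      A0 = 0 → A1 = c / 6 → A2 = 0 → A3 = c * β / 20 → A4 = 0 → A5 = c / 6 → A6 = 0 →
      d * B0 = -5 * c ^ 2 → d * B1 = 0 → d * B2 = 3 * β * c ^ 2 → d * B3 = 0 →
      d * B4 = -5 * c ^ 2 →
      d * (A0 * B4 - A1 * B3 + A2 * B2 - A3 * B1 + A4 * B0) = 0 ∧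
      d * (A2 * B4 - A3 * B3 + A4 * B2 - A5 * B1 + A6 * B0) = 0 := by
    rintro _ _ _ _ _ _ _ B0 B1 B2 B3 B4 d rfl rfl rfl rfl rfl rfl rfl g0 g1 g2 g3 g4
    constructor
    · linear_combination - c / 6 * g3 - c * β / 20 * g1
    · linear_combination - c / 6 * g1 - c * β / 20 * g3
  obtain ⟨k0, k2⟩ := hcov
    (p ^ 5 * r + p * r ^ 5 + β * p ^ 3 * r ^ 3)
    ((p ^ 5 * s + 5 * p ^ 4 * q * r + r ^ 5 * q + 5 * r ^ 4 * s * p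
      + β * (3 * p ^ 3 * r ^ 2 * s + 3 * p ^ 2 * q * r ^ 3)) / 6)
    ((5 * p ^ 4 * q * s + 10 * p ^ 3 * q ^ 2 * r + 5 * r ^ 4 * s * q
      + 10 * r ^ 3 * s ^ 2 * p
      + β * (3 * p ^ 3 * r * s ^ 2 + 9 * p ^ 2 * q * r ^ 2 * s + 3 * p * q ^ 2 * r ^ 3)) / 15)
    ((10 * p ^ 3 * q ^ 2 * s + 10 * p ^ 2 * q ^ 3 * r + 10 * r ^ 3 * s ^ 2 * q
      + 10 * r ^ 2 * s ^ 3 * p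
      + β * (p ^ 3 * s ^ 3 + 9 * p ^ 2 * q * r * s ^ 2 + 9 * p * q ^ 2 * r ^ 2 * s
        + q ^ 3 * r ^ 3)) / 20)
    ((10 * p ^ 2 * q ^ 3 * s + 5 * p * q ^ 4 * r + 10 * r ^ 2 * s ^ 3 * q
      + 5 * r * s ^ 4 * p
      + β * (3 * p ^ 2 * q * s ^ 3 + 9 * p * q ^ 2 * r * s ^ 2 + 3 * q ^ 3 * r ^ 2 * s)) / 15)
    ((5 * p * q ^ 4 * s + q ^ 5 * r + 5 * r * s ^ 4 * q + s ^ 5 * p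
      + β * (3 * p * q ^ 2 * s ^ 3 + 3 * q ^ 3 * r * s ^ 2)) / 6)
    (q ^ 5 * s + q * s ^ 5 + β * q ^ 3 * s ^ 3)
    _ _ _ _ _ _
    h0 (by linear_combination h1 / 6) (by linear_combination h2 / 15)
    (by linear_combination h3 / 20) (by linear_combination h4 / 15)
    (by linear_combination h5 / 6) h6 j0 j1 j2 j3 j4
  clear h h0 h1 h2 h3 h4 h5 h6 j0 j1 j2 j3 j4 hcov
  have hβ' : (3 * β) ^ 2 - 100 ≠ 0 := sub_ne_zero.mpr hβ
  constructor
  · have : (p * s - q * r) ^ 8 * ((3 * β) ^ 2 - 100) * (p * r) = 0 := by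
      linear_combination 30 * k0
    simpa only [mul_eq_zero, pow_eq_zero_iff, ne_eq, OfNat.ofNat_ne_zero, not_false_eq_true, hd,
      hβ', false_or] using this
  · have : (p * s - q * r) ^ 8 * ((3 * β) ^ 2 - 100) * (q * s) = 0 := by
      linear_combination 30 * k2
    simpa only [mul_eq_zero, pow_eq_zero_iff, ne_eq, OfNat.ofNat_ne_zero, not_false_eq_true, hd,
      hβ', false_or] using this

/-- A group generated by an element `s` of order `12` and an involution `t ∉ ⟨s⟩` with
`t s t⁻¹ = s⁷` is isomorphic to `ℤ/3 × D₈`. -/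
lemma exists_hom_zmod_three_prod_dihedral {G : Type*} [Group G] {s t : G}
    (hs : orderOf s = 12) (ht : t * t = 1) (hts : t * s = s ^ 7 * t) (hn : ∀ k : ℕ, t ≠ s ^ k) :
    ∃ e : Multiplicative (ZMod 3) × DihedralGroup 4 →* G,
      Function.Injective e ∧ e.range = Subgroup.closure {s, t} := by
  have hmod : ∀ {i j : ℕ}, i % 12 = j % 12 → s ^ i = s ^ j := fun {i j} h => by
    rw [pow_eq_pow_iff_modEq, hs]; exact h
  have hcomm : ∀ k : ℕ, t * s ^ k = s ^ (7 * k) * t := fun k => by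
    rw [pow_mul]
    exact SemiconjBy.pow_right hts k
  let D : DihedralGroup 4 → G
    | .r i => s ^ (3 * i.val)
    | .sr i => t * s ^ (3 * i.val)
  let f : Multiplicative (ZMod 3) × DihedralGroup 4 → G :=
    fun x => s ^ (4 * (Multiplicative.toAdd x.1).val) * D x.2
  have hval : ∀ a b : ZMod 3, 4 * (a + b).val % 12 = (4 * a.val + 4 * b.val) % 12 := by decide
  have h1 : ∀ i j : ZMod 4, 3 * (i + j).val % 12 = (3 * i.val + 3 * j.val) % 12 := by decide
  have h2 : ∀ i j : ZMod 4, 3 * (j - i).val % 12 = (7 * (3 * i.val) + 3 * j.val) % 12 := by decide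
  have hD : ∀ x y, D (x * y) = D x * D y := by
    rintro (i | i) (j | j)
    · simp only [DihedralGroup.r_mul_r, D]
      rw [← pow_add, hmod (h1 i j)]
    · simp only [DihedralGroup.r_mul_sr, D]
      rw [hmod (h2 i j), pow_add, ← mul_assoc t, ← mul_assoc _ t, hcomm]
      congr 2
      apply hmod
      omega
    · simp only [DihedralGroup.sr_mul_r, D]
      rw [mul_assoc, ← pow_add, hmod (h1 i j)]
    · simp only [DihedralGroup.sr_mul_sr, D]
      rw [hmod (h2 i j), pow_add, hcomm (3 * i.val)]
      simp only [mul_assoc, ← mul_assoc t t, ht, one_mul]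
  have hc : ∀ (k : ℕ) (x : DihedralGroup 4), s ^ (4 * k) * D x = D x * s ^ (4 * k) := by
    rintro k (i | i)
    · simp only [D]
      rw [← pow_add, ← pow_add, add_comm]
    · simp only [D]
      rw [mul_assoc, ← pow_add, add_comm, pow_add, ← mul_assoc, ← mul_assoc, hcomm (4 * k)]
      congr 2
      apply hmod
      omega
  let e : Multiplicative (ZMod 3) × DihedralGroup 4 →* G := MonoidHom.mk' f fun x y => by
    simp only [f, Prod.fst_mul, Prod.snd_mul, toAdd_mul, hD]
    rw [hmod (hval _ _), pow_add, mul_assoc, mul_assoc, ← mul_assoc _ (D x.2), hc]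
    simp only [mul_assoc]
  refine ⟨e, (injective_iff_map_eq_one e).mpr ?_, le_antisymm ?_ ?_⟩
  · rintro ⟨a, i | i⟩ h
    · change s ^ (4 * (Multiplicative.toAdd a).val) * s ^ (3 * i.val) = 1 at h
      rw [← pow_add, ← orderOf_dvd_iff_pow_eq_one, hs] at h
      have key : ∀ (a : ZMod 3) (i : ZMod 4), 12 ∣ 4 * a.val + 3 * i.val → a = 0 ∧ i = 0 := by
        decide
      obtain ⟨ha, rfl⟩ := key _ _ h
      exact Prod.ext ha rfl
    · change s ^ (4 * (Multiplicative.toAdd a).val) * (t * s ^ (3 * i.val)) = 1 at h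
      exfalso
      refine hn (8 * (Multiplicative.toAdd a).val + 9 * i.val) ?_
      generalize (Multiplicative.toAdd a).val = a at h
      calc t = s ^ (8 * a + 4 * a) * t * s ^ (3 * i.val + 9 * i.val) := by
            rw [hmod (j := 0) (by omega), hmod (i := 3 * i.val + 9 * i.val) (j := 0) (by omega)]
            simp
        _ = s ^ (8 * a) * (s ^ (4 * a) * (t * s ^ (3 * i.val))) * s ^ (9 * i.val) := by
            simp only [pow_add, mul_assoc]
        _ = _ := by rw [h, mul_one, pow_add]
  · rintro _ ⟨⟨a, i | i⟩, rfl⟩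
    · exact mul_mem (pow_mem (Subgroup.subset_closure (by simp)) _)
        (pow_mem (Subgroup.subset_closure (by simp)) _)
    · exact mul_mem (pow_mem (Subgroup.subset_closure (by simp)) _)
        (mul_mem (Subgroup.subset_closure (by simp))
          (pow_mem (Subgroup.subset_closure (by simp)) _))
  · rw [Subgroup.closure_le]
    rintro x (hx | hx)
    · rw [hx]
      refine ⟨(Multiplicative.ofAdd 1, .r 3), ?_⟩
      change s ^ (4 * 1) * s ^ (3 * 3) = s
      rw [← pow_add]
      exact (hmod (i := 4 * 1 + 3 * 3) (j := 1) rfl).trans (pow_one s)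
    · rw [hx]
      refine ⟨(Multiplicative.ofAdd 0, .sr 0), ?_⟩
      change s ^ (4 * 0) * (t * s ^ (3 * 0)) = t
      simp

lemma pgl_val {K : Type*} [Field K] (A : GL3 K) :
    pgl (A : Matrix (Fin 3) (Fin 3) K) = (QuotientGroup.mk A : PGL3 K) := by
  rw [pgl, dif_pos A.isUnit, IsUnit.unit_of_val_units]

lemma mk_eq_mk_of_val_eq_smul {K : Type*} [Field K] {A B : GL3 K} {a : K} (ha : a ≠ 0)
    (h : (A : Matrix (Fin 3) (Fin 3) K) = a • (B : Matrix (Fin 3) (Fin 3) K)) :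
    (QuotientGroup.mk A : PGL3 K) = QuotientGroup.mk B := by
  let u : GL3 K := Units.map (Matrix.scalar (Fin 3)).toMonoidHom (Units.mk0 a ha)
  have hu : u ∈ Subgroup.center (GL3 K) := by
    rw [Subgroup.mem_center_iff]
    intro g
    exact Units.ext (Matrix.scalar_commute a (fun r => Commute.all a r) g.val).symm
  have hA : A = u * B := by
    apply Units.ext
    rw [h, Units.val_mul]
    change _ = Matrix.scalar (Fin 3) a * _
    rw [Matrix.scalar_apply, Matrix.smul_eq_diagonal_mul]
  rw [hA, QuotientGroup.mk_mul, (QuotientGroup.eq_one_iff u).mpr hu, one_mul]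

/-- `diag(1, ζ, ζ⁷)` as an invertible matrix. -/
noncomputable def diagGL {K : Type*} [Field K] (ζ : K) (hζ : ζ ≠ 0) : GL3 K where
  val := !![1, 0, 0; 0, ζ, 0; 0, 0, ζ ^ 7]
  inv := !![1, 0, 0; 0, ζ⁻¹, 0; 0, 0, ζ⁻¹ ^ 7]
  val_inv := by
    ext i j
    fin_cases i <;> fin_cases j <;> simp [Matrix.mul_apply, Fin.sum_univ_three, hζ]
  inv_val := by
    ext i j
    fin_cases i <;> fin_cases j <;> simp [Matrix.mul_apply, Fin.sum_univ_three, hζ]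

/-- The invertible matrix exchanging the last two coordinates. -/
def swapGL (K : Type*) [Field K] : GL3 K where
  val := !![1, 0, 0; 0, 0, 1; 0, 1, 0]
  inv := !![1, 0, 0; 0, 0, 1; 0, 1, 0]
  val_inv := by
    ext i j
    fin_cases i <;> fin_cases j <;> simp [Matrix.mul_apply, Fin.sum_univ_three]
  inv_val := by
    ext i j
    fin_cases i <;> fin_cases j <;> simp [Matrix.mul_apply, Fin.sum_univ_three]

lemma diagGL_pow {K : Type*} [Field K] {ζ : K} (hζ : ζ ≠ 0) (k : ℕ) :
    ((diagGL ζ hζ ^ k : GL3 K) : Matrix (Fin 3) (Fin 3) K)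
      = !![1, 0, 0; 0, ζ ^ k, 0; 0, 0, ζ ^ (7 * k)] := by
  induction k with
  | zero =>
    ext i j
    fin_cases i <;> fin_cases j <;> simp
  | succ k ih =>
    rw [pow_succ, Units.val_mul, ih]
    ext i j
    fin_cases i <;> fin_cases j <;>
      simp [Matrix.mul_apply, Fin.sum_univ_three, diagGL] <;> ring

lemma diagGL_pow_mem_center {K : Type*} [Field K] {ζ : K} {hζ : ζ ≠ 0} {k : ℕ}
    (h : diagGL ζ hζ ^ k ∈ Subgroup.center (GL3 K)) : ζ ^ k = 1 := by
  have hP : (!![0, 1, 0; 1, 0, 0; 0, 0, 1] : Matrix (Fin 3) (Fin 3) K)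
      * !![0, 1, 0; 1, 0, 0; 0, 0, 1] = 1 := by
    ext i j
    fin_cases i <;> fin_cases j <;> simp [Matrix.mul_apply, Fin.sum_univ_three]
  have h' := congrArg (fun g : GL3 K => (g : Matrix (Fin 3) (Fin 3) K) 0 1)
    (Subgroup.mem_center_iff.mp h ⟨_, _, hP, hP⟩)
  simp only [Units.val_mul, diagGL_pow] at h'
  simpa [Matrix.mul_apply, Fin.sum_univ_three] using h'

lemma orderOf_mk_diagGL {K : Type*} [Field K] {ζ : K} (h : IsPrimitiveRoot ζ 12) (hζ : ζ ≠ 0) :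
    orderOf (QuotientGroup.mk (diagGL ζ hζ) : PGL3 K) = 12 := by
  apply Nat.dvd_antisymm
  · rw [orderOf_dvd_iff_pow_eq_one, ← QuotientGroup.mk_pow]
    suffices diagGL ζ hζ ^ 12 = 1 by rw [this]; rfl
    apply Units.ext
    rw [diagGL_pow, pow_mul', h.pow_eq_one, one_pow]
    ext i j
    fin_cases i <;> fin_cases j <;> simp
  · apply h.dvd_of_pow_eq_one
    apply diagGL_pow_mem_center (hζ := hζ)
    rw [← QuotientGroup.eq_one_iff, QuotientGroup.mk_pow, pow_orderOf_eq_one]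

lemma swapGL_mul_self (K : Type*) [Field K] : swapGL K * swapGL K = 1 :=
  Units.ext (swapGL K).mul_inv

lemma swapGL_mul_diagGL {K : Type*} [Field K] {ζ : K} (h : ζ ^ 12 = 1) (hζ : ζ ≠ 0) :
    swapGL K * diagGL ζ hζ = diagGL ζ hζ ^ 7 * swapGL K := by
  apply Units.ext
  have h49 : ζ ^ 49 = ζ := by
    linear_combination ζ * (ζ ^ 36 + ζ ^ 24 + ζ ^ 12 + 1) * h
  rw [Units.val_mul, Units.val_mul, diagGL_pow]
  ext i j
  fin_cases i <;> fin_cases j <;>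
    simp [Matrix.mul_apply, Fin.sum_univ_three, diagGL, swapGL, h49]

lemma mk_swapGL_ne_pow {K : Type*} [Field K] [CharZero K] {ζ : K} (hζ : ζ ≠ 0) (k : ℕ) :
    (QuotientGroup.mk (swapGL K) : PGL3 K) ≠ QuotientGroup.mk (diagGL ζ hζ) ^ k := by
  intro h
  rw [← QuotientGroup.mk_pow, QuotientGroup.eq,
    inv_eq_of_mul_eq_one_left (swapGL_mul_self K)] at h
  have hE : (!![1, 0, 0; 0, -1, 0; 0, 0, 1] : Matrix (Fin 3) (Fin 3) K)
      * !![1, 0, 0; 0, -1, 0; 0, 0, 1] = 1 := by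
    ext i j
    fin_cases i <;> fin_cases j <;> simp [Matrix.mul_apply, Fin.sum_univ_three]
  have h' := congrArg (fun g : GL3 K => (g : Matrix (Fin 3) (Fin 3) K) 1 2)
    (Subgroup.mem_center_iff.mp h ⟨_, _, hE, hE⟩)
  simp only [Units.val_mul, diagGL_pow, swapGL] at h'
  simp [Matrix.mul_apply, Fin.sum_univ_three, neg_eq_self, hζ] at h'

lemma eq_of_matAct_eq {K : Type*} [Field K] [CharZero K] {ζ : K} (h : IsPrimitiveRoot ζ 12)
    (hζ : ζ ≠ 0) {β c : K} (hβ0 : β ≠ 0) (hβ : (3 * β) ^ 2 ≠ 100) (hc : c ≠ 0) (A : GL3 K)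
    (hA : matAct (A : Matrix (Fin 3) (Fin 3) K) (X 0 ^ 6 + X 1 ^ 5 * X 2 + X 1 * X 2 ^ 5
      + C β * X 1 ^ 3 * X 2 ^ 3) = c • (X 0 ^ 6 + X 1 ^ 5 * X 2 + X 1 * X 2 ^ 5
      + C β * X 1 ^ 3 * X 2 ^ 3 : MvPolynomial (Fin 3) K)) :
    ∃ k : ℕ, (QuotientGroup.mk A : PGL3 K) = QuotientGroup.mk (diagGL ζ hζ ^ k) ∨
      (QuotientGroup.mk A : PGL3 K) = QuotientGroup.mk (diagGL ζ hζ ^ k * swapGL K) := by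
  obtain ⟨A, B, hAB, hBA⟩ := A
  change matAct A _ = _ at hA
  have hF : ∀ x y z : K,
      (A 0 0 * x + A 0 1 * y + A 0 2 * z) ^ 6
      + (A 1 0 * x + A 1 1 * y + A 1 2 * z) ^ 5 * (A 2 0 * x + A 2 1 * y + A 2 2 * z)
      + (A 1 0 * x + A 1 1 * y + A 1 2 * z) * (A 2 0 * x + A 2 1 * y + A 2 2 * z) ^ 5
      + β * (A 1 0 * x + A 1 1 * y + A 1 2 * z) ^ 3 * (A 2 0 * x + A 2 1 * y + A 2 2 * z) ^ 3
      = c * (x ^ 6 + y ^ 5 * z + y * z ^ 5 + β * y ^ 3 * z ^ 3) := fun x y z => by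
    have := congrArg (eval ![x, y, z]) hA
    simp [matAct, Fin.sum_univ_three] at this
    linear_combination this
  have hD : ∀ v : Fin 3 → K, 6 * A 0 0 * (A.mulVec v 0) ^ 5
      + A 1 0 * (5 * (A.mulVec v 1) ^ 4 * A.mulVec v 2 + (A.mulVec v 2) ^ 5
        + 3 * β * (A.mulVec v 1) ^ 2 * (A.mulVec v 2) ^ 3)
      + A 2 0 * ((A.mulVec v 1) ^ 5 + 5 * A.mulVec v 1 * (A.mulVec v 2) ^ 4
        + 3 * β * (A.mulVec v 1) ^ 3 * (A.mulVec v 2) ^ 2)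
      = 6 * c * v 0 ^ 5 := fun v => by
    have := congrArg (fun P => eval v (pderiv 0 P)) hA
    simp [matAct, Fin.sum_univ_three, pderiv_X, Derivation.leibniz_pow] at this
    simp only [Matrix.mulVec, dotProduct, Fin.sum_univ_three]
    linear_combination this
  have hw : A 0 0 ≠ 0 ∨ A 1 0 ≠ 0 ∨ A 2 0 ≠ 0 := by
    by_contra! hw
    have := congrFun (congrFun hBA 0) 0
    simp [Matrix.mul_apply, Fin.sum_univ_three, hw] at this
  obtain ⟨h10, h20, hl, hm, hn⟩ := polar_eq_pow_five (β := β) (c := c) (w₀ := A 0 0)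
    (w₁ := A 1 0) (w₂ := A 2 0) (l := B 0 0) (m := B 0 1) (n := B 0 2) hβ hc hw
    fun x y z => by
      have := hD (B.mulVec ![x, y, z])
      rw [Matrix.mulVec_mulVec, hAB, Matrix.one_mulVec] at this
      simpa [Matrix.mulVec, dotProduct, Fin.sum_univ_three] using this
  have h01 : A 0 1 = 0 := by
    simpa [Matrix.mul_apply, Fin.sum_univ_three, hm, hn, hl] using congrFun (congrFun hBA 0) 1
  have h02 : A 0 2 = 0 := by
    simpa [Matrix.mul_apply, Fin.sum_univ_three, hm, hn, hl] using congrFun (congrFun hBA 0) 2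
  have hdet : IsUnit A.det := Matrix.isUnit_det_of_right_inverse hAB
  rw [Matrix.det_fin_three, h10, h20, h01, h02] at hdet
  replace hdet : A 0 0 * (A 1 1 * A 2 2 - A 1 2 * A 2 1) ≠ 0 := by
    convert hdet.ne_zero using 1
    ring
  have ha : A 0 0 ≠ 0 := left_ne_zero_of_mul hdet
  have ha6 : A 0 0 ^ 6 = c := by simpa [h10, h20] using hF 1 0 0
  have hG : ∀ y z : K, (A 1 1 * y + A 1 2 * z) ^ 5 * (A 2 1 * y + A 2 2 * z)
      + (A 1 1 * y + A 1 2 * z) * (A 2 1 * y + A 2 2 * z) ^ 5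
      + β * (A 1 1 * y + A 1 2 * z) ^ 3 * (A 2 1 * y + A 2 2 * z) ^ 3
      = c * (y ^ 5 * z + y * z ^ 5 + β * y ^ 3 * z ^ 3) := fun y z => by
    simpa [h01, h02] using hF 0 y z
  have hdet' := right_ne_zero_of_mul hdet
  obtain ⟨hpr, hqs⟩ := binary_sextic_semiinvariant hβ0 hβ hdet' hG
  -- the nonzero entries of a monomial solution
  have hmono : ∀ p s : K, p ≠ 0 → s ≠ 0 → p ^ 5 * s = c → β * (p ^ 3 * s ^ 3) = c * β →
      ∃ k : ℕ, p = A 0 0 * ζ ^ k ∧ s = A 0 0 * ζ ^ (7 * k) := by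
    intro p s hp hs h1 h2
    have hsq : s ^ 2 = p ^ 2 := by
      have : β * p ^ 3 * s * (s ^ 2 - p ^ 2) = 0 := by linear_combination h2 - β * h1
      simpa [hβ0, hp, hs, sub_eq_zero] using this
    have h6 : p ^ 5 * s = A 0 0 ^ 6 := h1.trans ha6.symm
    have h12 : (p / A 0 0) ^ 12 = 1 := by
      rw [div_pow, div_eq_one_iff_eq (pow_ne_zero _ ha)]
      linear_combination - p ^ 10 * hsq + (p ^ 5 * s + A 0 0 ^ 6) * h6
    obtain ⟨k, -, hk⟩ := h.eq_pow_of_pow_eq_one h12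
    refine ⟨k, by rw [hk]; field_simp, ?_⟩
    rw [pow_mul', hk, div_pow]
    field_simp
    rw [← h6]
    linear_combination p ^ 5 * hsq
  rcases mul_eq_zero.mp hpr with hp | hr
  · have h12 : A 1 2 ≠ 0 := fun h0 => hdet' (by rw [hp, h0]; ring)
    have h21 : A 2 1 ≠ 0 := fun h0 => hdet' (by rw [hp, h0]; ring)
    have h22 : A 2 2 = 0 := (mul_eq_zero.mp hqs).resolve_left h12
    obtain ⟨-, -, -, g3, -, g5, -⟩ := coeff_eq_zero_of_forall_sextic_eq_zero
      (a₀ := 0) (a₁ := A 1 2 * A 2 1 ^ 5 - c) (a₂ := 0)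
      (a₃ := β * (A 1 2 ^ 3 * A 2 1 ^ 3) - c * β) (a₄ := 0)
      (a₅ := A 1 2 ^ 5 * A 2 1 - c) (a₆ := 0)
      fun t => by
        have := hG 1 t
        rw [hp, h22] at this
        linear_combination this
    obtain ⟨k, e1, e2⟩ := hmono _ _ h12 h21 (sub_eq_zero.mp g5) (sub_eq_zero.mp g3)
    refine ⟨k, Or.inr (mk_eq_mk_of_val_eq_smul ha ?_)⟩
    rw [Units.val_mul, diagGL_pow]
    ext i j
    fin_cases i <;> fin_cases j <;>
      simp [swapGL, h01, h02, h10, h20, hp, h22, e1, e2]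
  · have h11 : A 1 1 ≠ 0 := fun h0 => hdet' (by rw [hr, h0]; ring)
    have h22 : A 2 2 ≠ 0 := fun h0 => hdet' (by rw [hr, h0]; ring)
    have h12 : A 1 2 = 0 := (mul_eq_zero.mp hqs).resolve_right h22
    obtain ⟨-, g1, -, g3, -, -, -⟩ := coeff_eq_zero_of_forall_sextic_eq_zero
      (a₀ := 0) (a₁ := A 1 1 ^ 5 * A 2 2 - c) (a₂ := 0)
      (a₃ := β * (A 1 1 ^ 3 * A 2 2 ^ 3) - c * β) (a₄ := 0)
      (a₅ := A 1 1 * A 2 2 ^ 5 - c) (a₆ := 0)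
      fun t => by
        have := hG 1 t
        rw [hr, h12] at this
        linear_combination this
    obtain ⟨k, e1, e2⟩ := hmono _ _ h11 h22 (sub_eq_zero.mp g1) (sub_eq_zero.mp g3)
    refine ⟨k, Or.inl (mk_eq_mk_of_val_eq_smul ha ?_)⟩
    rw [diagGL_pow]
    ext i j
    fin_cases i <;> fin_cases j <;> simp [h01, h02, h10, h20, hr, h12, e1, e2]

lemma matAct_diagGL {K : Type*} [Field K] {ζ : K} (h : ζ ^ 12 = 1) (hζ : ζ ≠ 0) (β : K) :
    matAct (diagGL ζ hζ : Matrix (Fin 3) (Fin 3) K) (X 0 ^ 6 + X 1 ^ 5 * X 2 + X 1 * X 2 ^ 5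
      + C β * X 1 ^ 3 * X 2 ^ 3) = (X 0 ^ 6 + X 1 ^ 5 * X 2 + X 1 * X 2 ^ 5
      + C β * X 1 ^ 3 * X 2 ^ 3 : MvPolynomial (Fin 3) K) := by
  have hC : (C ζ : MvPolynomial (Fin 3) K) ^ 12 = 1 := by rw [← C_pow, h, C_1]
  simp [matAct, Fin.sum_univ_three, diagGL]
  linear_combination (X 1 ^ 5 * X 2 + X 1 * X 2 ^ 5 * (C ζ ^ 24 + C ζ ^ 12 + 1)
    + C β * X 1 ^ 3 * X 2 ^ 3 * (C ζ ^ 12 + 1)) * hC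

lemma matAct_swapGL {K : Type*} [Field K] (β : K) :
    matAct (swapGL K : Matrix (Fin 3) (Fin 3) K) (X 0 ^ 6 + X 1 ^ 5 * X 2 + X 1 * X 2 ^ 5
      + C β * X 1 ^ 3 * X 2 ^ 3) = (X 0 ^ 6 + X 1 ^ 5 * X 2 + X 1 * X 2 ^ 5
      + C β * X 1 ^ 3 * X 2 ^ 3 : MvPolynomial (Fin 3) K) := by
  simp [matAct, Fin.sum_univ_three, swapGL]
  ring

/-- For `β ∉ {0, 10/3, −10/3}` with `X⁶ + Y⁵Z + YZ⁵ + βY³Z³` smooth, the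
automorphism group is generated by `σ = diag(1, ζ₁₂, ζ₁₂⁷)` and `τ = [X:Z:Y]`, has order `24`,
and is isomorphic to `Z/3Z × D₈` (`D₈` the dihedral group of order `8`). -/
theorem typeTwelve_sextic_automorphisms {K : Type*} [Field K] [IsAlgClosed K] [CharZero K]
    (ζ : K) (hζ : IsPrimitiveRoot ζ 12) (β : K)
    (hβ0 : β ≠ 0) (hβ1 : β ≠ 10 / 3) (hβ2 : β ≠ -(10 / 3))
    (hsm : IsSmoothSextic (X 0 ^ 6 + X 1 ^ 5 * X 2 + X 1 * X 2 ^ 5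
      + C β * X 1 ^ 3 * X 2 ^ 3 : MvPolynomial (Fin 3) K)) :
    planeAut (X 0 ^ 6 + X 1 ^ 5 * X 2 + X 1 * X 2 ^ 5
        + C β * X 1 ^ 3 * X 2 ^ 3 : MvPolynomial (Fin 3) K)
      = Subgroup.closure
        {pgl !![1, 0, 0; 0, ζ, 0; 0, 0, ζ ^ 7], pgl !![(1 : K), 0, 0; 0, 0, 1; 0, 1, 0]} ∧
    Nat.card ↥(planeAut (X 0 ^ 6 + X 1 ^ 5 * X 2 + X 1 * X 2 ^ 5
      + C β * X 1 ^ 3 * X 2 ^ 3 : MvPolynomial (Fin 3) K)) = 24 ∧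
    Nonempty (↥(planeAut (X 0 ^ 6 + X 1 ^ 5 * X 2 + X 1 * X 2 ^ 5
        + C β * X 1 ^ 3 * X 2 ^ 3 : MvPolynomial (Fin 3) K))
      ≃* Multiplicative (ZMod 3) × DihedralGroup 4) := by
  have hζ0 : ζ ≠ 0 := hζ.ne_zero (by norm_num)
  have hβ : (3 * β) ^ 2 ≠ 100 := by
    intro h
    have : (β - 10 / 3) * (β - -(10 / 3)) = 0 := by linear_combination h / 9
    rcases mul_eq_zero.mp this with h | h
    · exact hβ1 (sub_eq_zero.mp h)
    · exact hβ2 (sub_eq_zero.mp h)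
  have hS := pgl_val (diagGL ζ hζ0)
  have hT := pgl_val (swapGL K)
  simp only [diagGL, swapGL] at hS hT
  obtain ⟨e, he, hr⟩ := exists_hom_zmod_three_prod_dihedral
    (orderOf_mk_diagGL hζ hζ0)
    (congrArg QuotientGroup.mk (swapGL_mul_self K))
    (congrArg QuotientGroup.mk (swapGL_mul_diagGL hζ.pow_eq_one hζ0))
    (mk_swapGL_ne_pow hζ0)
  have hmain : planeAut (X 0 ^ 6 + X 1 ^ 5 * X 2 + X 1 * X 2 ^ 5
      + C β * X 1 ^ 3 * X 2 ^ 3 : MvPolynomial (Fin 3) K)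
      = Subgroup.closure {QuotientGroup.mk (diagGL ζ hζ0), QuotientGroup.mk (swapGL K)} := by
    apply le_antisymm
    · rintro _ ⟨A, rfl, c, hc, hA⟩
      obtain ⟨k, hk | hk⟩ := eq_of_matAct_eq hζ hζ0 hβ0 hβ hc A hA
      · rw [hk, QuotientGroup.mk_pow]
        exact pow_mem (Subgroup.subset_closure (by simp)) _
      · rw [hk, QuotientGroup.mk_mul, QuotientGroup.mk_pow]
        exact mul_mem (pow_mem (Subgroup.subset_closure (by simp)) _)
          (Subgroup.subset_closure (by simp))
    · rw [Subgroup.closure_le]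
      rintro x (hx | hx)
      · exact ⟨_, hx.symm, 1, one_ne_zero,
          (matAct_diagGL hζ.pow_eq_one hζ0 β).trans (one_smul K _).symm⟩
      · exact ⟨_, hx.symm, 1, one_ne_zero, (matAct_swapGL β).trans (one_smul K _).symm⟩
  let E := (MonoidHom.ofInjective he).trans (MulEquiv.subgroupCongr (hr.trans hmain.symm))
  refine ⟨?_, ?_, ⟨E.symm⟩⟩
  · rw [hS, hT]
    exact hmain
  · rw [← Nat.card_congr E.toEquiv, Nat.card_prod, DihedralGroup.nat_card]
    simp
end

section
/- Let β ∈ K with β = 10/3 or β = −10/3. Then the plane sextic defined by F = X⁶ + Y⁵Z + YZ⁵ + βY³Z³ is projectively equivalent over K to the Fermat sextic: there exist a matrix A ∈ GL₃(K) and a scalar λ ∈ K× such that F(A·(X,Y,Z)ᵗ) = λ·(X⁶ + Y⁶ + Z⁶). -/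
open MvPolynomial

variable {K : Type*} [Field K]

/-- If `s⁵ = s`, `3t = 1` and `βs³ = 10ts`, the binary form `Y⁵Z + YZ⁵ + βY³Z³` becomes
`16ts(p⁶ - q⁶)` at `Y = p + q`, `Z = s(p - q)`. -/
lemma binary_sextic_eq_sub_pow {R : Type*} [CommRing R] {β s t : R} (p q : R)
    (hs : s ^ 5 = s) (ht : 3 * t = 1) (hβ : β * s ^ 3 = 10 * t * s) :
    (p + q) ^ 5 * (s * (p - q)) + (p + q) * (s * (p - q)) ^ 5
      + β * (p + q) ^ 3 * (s * (p - q)) ^ 3 = 16 * t * s * (p ^ 6 - q ^ 6) := by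
  linear_combination (p + q) * (p - q) ^ 5 * hs + (p ^ 2 - q ^ 2) ^ 3 * hβ
    - 2 * s * (p ^ 2 - q ^ 2) * (p ^ 4 + 6 * p ^ 2 * q ^ 2 + q ^ 4) * ht

lemma exists_fourth_root_of_unity_mul_cube_eq {K : Type*} [Field K] [IsAlgClosed K]
    {β : K} (hβ : β = 10 / 3 ∨ β = -(10 / 3)) :
    ∃ s : K, s ≠ 0 ∧ s ^ 5 = s ∧ β * s ^ 3 = 10 * 3⁻¹ * s := by
  rcases hβ with rfl | rfl
  · exact ⟨1, one_ne_zero, by ring, by ring⟩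
  · obtain ⟨s, hs⟩ := IsAlgClosed.exists_pow_nat_eq (-1 : K) (n := 2) two_pos
    refine ⟨s, ?_, ?_, ?_⟩
    · rintro rfl
      simp at hs
    · linear_combination (s ^ 3 - s) * hs
    · linear_combination (-(10 / 3) * s) * hs

/-- For `β = 10/3` or `β = −10/3`, the sextic `X⁶ + Y⁵Z + YZ⁵ + βY³Z³` is
projectively equivalent over `K` to the Fermat sextic `X⁶ + Y⁶ + Z⁶`. -/
theorem typeTwelve_sextic_fermat_case {K : Type*} [Field K] [IsAlgClosed K] [CharZero K]
    (β : K) (hβ : β = 10 / 3 ∨ β = -(10 / 3)) :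
    ∃ A : Matrix (Fin 3) (Fin 3) K, IsUnit A ∧ ∃ c : K, c ≠ 0 ∧
      matAct A (X 0 ^ 6 + X 1 ^ 5 * X 2 + X 1 * X 2 ^ 5
          + C β * X 1 ^ 3 * X 2 ^ 3 : MvPolynomial (Fin 3) K)
        = c • (X 0 ^ 6 + X 1 ^ 6 + X 2 ^ 6 : MvPolynomial (Fin 3) K) := by
  obtain ⟨s, hs0, hs, hβs⟩ := exists_fourth_root_of_unity_mul_cube_eq hβ
  obtain ⟨a, ha⟩ := IsAlgClosed.exists_pow_nat_eq (3 / (16 * s)) (n := 6) (by norm_num)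
  obtain ⟨b, hb⟩ := IsAlgClosed.exists_pow_nat_eq (-(3 / (16 * s))) (n := 6) (by norm_num)
  have ha0 : a ≠ 0 := by
    rintro rfl
    have : (3 : K) / (16 * s) ≠ 0 := by simp [hs0]
    exact this (by simpa using ha.symm)
  have hb0 : b ≠ 0 := by
    rintro rfl
    have : -((3 : K) / (16 * s)) ≠ 0 := by simp [hs0]
    exact this (by rw [← hb]; simp)
  have ha1 : 16 * 3⁻¹ * s * a ^ 6 = 1 := by
    rw [ha]
    field_simp
  have hb1 : 16 * 3⁻¹ * s * b ^ 6 = -1 := by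
    rw [hb]
    field_simp
  refine ⟨!![1, 0, 0; 0, a, b; 0, s * a, -(s * b)], ?_, 1, one_ne_zero, ?_⟩
  · rw [Matrix.isUnit_iff_isUnit_det, isUnit_iff_ne_zero, Matrix.det_fin_three]
    have : -(2 * s * a * b) ≠ 0 := by simp [hs0, ha0, hb0]
    convert this using 1
    simp
    ring
  · have key := binary_sextic_eq_sub_pow (C a * X 1 : MvPolynomial (Fin 3) K) (C b * X 2)
      (β := C β) (s := C s) (t := C 3⁻¹)
      (by rw [← map_pow, hs])
      (by rw [← map_ofNat C 3, ← map_mul, mul_inv_cancel₀ three_ne_zero, map_one])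
      (by simpa only [map_mul, map_pow, map_ofNat] using
        congrArg (C : K → MvPolynomial (Fin 3) K) hβs)
    have hca := congrArg (C : K → MvPolynomial (Fin 3) K) ha1
    have hcb := congrArg (C : K → MvPolynomial (Fin 3) K) hb1
    simp only [map_mul, map_pow, map_neg, map_one, map_ofNat] at hca hcb
    simp [matAct, Fin.sum_univ_three, algebraMap_eq]
    linear_combination key + X 1 ^ 6 * hca - X 2 ^ 6 * hcb
end
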